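/- Under the weighted Kendall-tau distance, for permutations x, y and Q = {π_1, π_2, π_3}, we have d^w_τ(x, y) ≤ ‖B_x‖_w + ‖B_y‖_w, where B_x is the set of pairs whose order in x disagrees with the majority order over Q, and ‖S‖_w = Σ_{{a,b}∈S} (w(a)+w(b))/2. Moreover ‖B_x‖_w ≤ Δ(x, Q), the total slack of x with respect to Q under d^w_τ. -/

import Mathlib

/-- The pair `{e,e'}` is inverted between permutations `p` and `q`. -/
def inverted {n : ℕ} (p q : Equiv.Perm (Fin n)) (e e' : Fin n) : Prop :=
  (((p.symm e : ℕ) : ℤ) - ((p.symm e' : ℕ) : ℤ)) *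
    (((q.symm e : ℕ) : ℤ) - ((q.symm e' : ℕ) : ℤ)) < 0

open Classical in
/-- Element-weighted Kendall-tau distance. -/
noncomputable def ktW {n : ℕ} (w : Fin n → ℝ) (p q : Equiv.Perm (Fin n)) : ℝ :=
  ∑ e : Fin n, ∑ e' : Fin n,
    if e < e' ∧ inverted p q e e' then (w e + w e') / 2 else 0

/-- For distinct elements, being inverted means being ordered differently. -/
theorem inverted_iff_of_ne {n : ℕ} (p q : Equiv.Perm (Fin n)) {a b : Fin n} (hab : a ≠ b) :
    inverted p q a b ↔ ¬ (p.symm a < p.symm b ↔ q.symm a < q.symm b) := by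
  have hp : (p.symm a : ℕ) ≠ p.symm b := fun h => hab (p.symm.injective (Fin.ext h))
  have hq : (q.symm a : ℕ) ≠ q.symm b := fun h => hab (q.symm.injective (Fin.ext h))
  unfold inverted
  rw [mul_neg_iff, Fin.lt_def, Fin.lt_def]
  omega

open Classical in
/-- Under weighted Kendall-tau, `d^w_τ(x,y) ≤ ‖B_x‖_w + ‖B_y‖_w` where `B_x` is
the set of pairs disagreeing with the majority order over `Q = {π₁,π₂,π₃}`;
moreover `‖B_x‖_w ≤ Δ(x,Q)`. -/
theorem kendall_majority_bounds {n : ℕ} (w : Fin n → ℝ) (hw : ∀ e, 0 ≤ w e)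
    (π : Fin 3 → Equiv.Perm (Fin n)) (x y : Equiv.Perm (Fin n)) :
    let agree : Equiv.Perm (Fin n) → Equiv.Perm (Fin n) → Fin n → Fin n → Prop :=
      fun p q a b => (p.symm a < p.symm b ↔ q.symm a < q.symm b)
    let MajCons : Equiv.Perm (Fin n) → Fin n → Fin n → Prop :=
      fun p a b => 2 ≤ (Finset.univ.filter (fun i : Fin 3 => agree p (π i) a b)).card
    let wB : Equiv.Perm (Fin n) → ℝ := fun p =>
      ∑ a : Fin n, ∑ b : Fin n,
        if a < b ∧ ¬ MajCons p a b then (w a + w b) / 2 else 0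
    (ktW w x y ≤ wB x + wB y) ∧
    (wB x ≤ ∑ i : Fin 3, ∑ j : Fin 3,
      if i < j then ktW w x (π i) + ktW w x (π j) - ktW w (π i) (π j) else 0) := by
  intro agree MajCons wB
  have majCons_iff (p : Equiv.Perm (Fin n)) (a b : Fin n) : MajCons p a b ↔
      2 ≤ (if agree p (π 0) a b then 1 else 0) + (if agree p (π 1) a b then 1 else 0) +
        (if agree p (π 2) a b then 1 else 0) := by
    simp only [MajCons, Finset.card_filter, Fin.sum_univ_three]
  have pair_nonneg (a b : Fin n) : 0 ≤ (w a + w b) / 2 := by linarith [hw a, hw b]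
  constructor
  · simp only [ktW, wB, ← Finset.sum_add_distrib]
    refine Finset.sum_le_sum fun a _ => Finset.sum_le_sum fun b _ => ?_
    have hc := pair_nonneg a b
    by_cases hab : a < b
    · simp only [hab, true_and, inverted_iff_of_ne _ _ hab.ne, majCons_iff, agree]
      generalize (w a + w b) / 2 = c at hc ⊢
      by_cases hx : x.symm a < x.symm b <;> by_cases hy : y.symm a < y.symm b <;>
      by_cases h0 : (π 0).symm a < (π 0).symm b <;>
      by_cases h1 : (π 1).symm a < (π 1).symm b <;>
      by_cases h2 : (π 2).symm a < (π 2).symm b <;>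
      simp [hx, hy, h0, h1, h2, hc]
    · simp [hab]
  · simp only [Fin.sum_univ_three, Fin.reduceLT, if_true, if_false, ktW, wB,
      ← Finset.sum_add_distrib, ← Finset.sum_sub_distrib, zero_add, add_zero, lt_self_iff_false]
    refine Finset.sum_le_sum fun a _ => Finset.sum_le_sum fun b _ => ?_
    have hc := pair_nonneg a b
    by_cases hab : a < b
    · simp only [hab, true_and, inverted_iff_of_ne _ _ hab.ne, majCons_iff, agree]
      generalize (w a + w b) / 2 = c at hc ⊢
      by_cases hx : x.symm a < x.symm b <;>
      by_cases h0 : (π 0).symm a < (π 0).symm b <;>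
      by_cases h1 : (π 1).symm a < (π 1).symm b <;>
      by_cases h2 : (π 2).symm a < (π 2).symm b <;>
      simp [hx, h0, h1, h2] <;> linarith
    · simp [hab]
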